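/- Consider the following four matrices in GL₄(ℤ): s₁ = [[0,−1,1,−1],[1,−1,1,0],[0,0,1,0],[0,0,0,1]], s₂ = [[−1,1,0,−1],[0,1,0,0],[0,0,1,0],[0,0,0,1]], s₃ = [[0,0,1,−1],[0,1,0,0],[1,0,0,1],[0,0,0,1]], s₄ = [[1,0,−1,1],[0,1,−1,0],[0,0,0,−1],[0,0,1,−1]]. The subgroup of GL₄(ℤ) generated by {s₁, s₂, s₃, s₄} is a finite group of order 1152. -/

import Mathlib

open Subgroup in
/-- If the elements `T i`, lying in the group generated by `σ`, form a system of left coset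
representatives for the subgroup generated by `τ`, as witnessed by the action of the `σ s` on them
and by an invariant `f` of left cosets that separates them, then the index is the number of
representatives. -/
theorem card_closure_range_eq_mul {G Y ι κ : Type*} [Group G] {n : ℕ} (σ : ι → G) (τ : κ → G)
    (T : Fin n → G) (f : G → Y)
    (hτ : ∀ k, τ k ∈ closure (Set.range σ))
    (hone : ∃ i, T i = 1)
    (hT : ∀ i, T i = 1 ∨ ∃ j < i, ∃ s, T i = σ s * T j)
    (hmul : ∀ s i, ∃ j, ∃ h ∈ closure (Set.range τ), σ s * T i = T j * h)
    (hf : ∀ g k, f (g * τ k) = f g)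
    (hinj : Function.Injective (f ∘ T)) :
    Nat.card (closure (Set.range σ)) = n * Nat.card (closure (Set.range τ)) := by
  have hle : closure (Set.range τ) ≤ closure (Set.range σ) := by
    rw [closure_le]
    rintro _ ⟨k, rfl⟩
    exact hτ k
  have hfH : ∀ h ∈ closure (Set.range τ), ∀ g, f (g * h) = f g := by
    intro h hh
    induction hh using closure_induction with
    | mem x hx =>
      obtain ⟨k, rfl⟩ := hx
      exact fun g => hf g k
    | one => simp
    | mul x y _ _ hx hy => intro g; rw [← mul_assoc, hy, hx]
    | inv x _ hx => intro g; rw [← hx (g * x⁻¹), inv_mul_cancel_right]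
  have hTmem : ∀ i, T i ∈ closure (Set.range σ) := by
    intro i
    induction i using WellFoundedLT.induction with
    | _ i ih =>
      rcases hT i with h | ⟨j, hj, s, h⟩
      · rw [h]; exact one_mem _
      · rw [h]; exact mul_mem (subset_closure ⟨s, rfl⟩) (ih j hj)
  have hmul_inv : ∀ s i, ∃ j, ∃ h ∈ closure (Set.range τ), (σ s)⁻¹ * T i = T j * h := by
    intro s
    choose p h hh hp using hmul s
    have hp_inj : Function.Injective p := by
      intro i j hij
      apply hinj
      have key : T i = T j * ((h j)⁻¹ * h i) := by
        apply mul_left_cancel (a := σ s)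
        rw [← mul_assoc, hp i, hp j, hij]
        group
      simp only [Function.comp_apply, key]
      exact hfH _ (mul_mem (inv_mem (hh j)) (hh i)) _
    intro i
    obtain ⟨j, rfl⟩ := (Finite.injective_iff_surjective.mp hp_inj) i
    refine ⟨j, (h j)⁻¹, inv_mem (hh j), ?_⟩
    rw [inv_mul_eq_iff_eq_mul, ← mul_assoc, hp j, mul_inv_cancel_right]
  have hcover : ∀ g ∈ closure (Set.range σ), ∃ i, ∃ h ∈ closure (Set.range τ), g = T i * h := by
    intro g hg
    induction hg using closure_induction_left with
    | one =>
      obtain ⟨i, hi⟩ := hone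
      exact ⟨i, 1, one_mem _, by rw [hi, mul_one]⟩
    | mul_left x hx y _ ih =>
      obtain ⟨s, rfl⟩ := hx
      obtain ⟨i, h, hh, rfl⟩ := ih
      obtain ⟨j, h', hh', e⟩ := hmul s i
      exact ⟨j, h' * h, mul_mem hh' hh, by rw [← mul_assoc, e, mul_assoc]⟩
    | inv_mul_cancel x hx y _ ih =>
      obtain ⟨s, rfl⟩ := hx
      obtain ⟨i, h, hh, rfl⟩ := ih
      obtain ⟨j, h', hh', e⟩ := hmul_inv s i
      exact ⟨j, h' * h, mul_mem hh' hh, by rw [← mul_assoc, e, mul_assoc]⟩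
  let φ : Fin n × closure (Set.range τ) → closure (Set.range σ) :=
    fun p => ⟨T p.1 * p.2, mul_mem (hTmem p.1) (hle p.2.2)⟩
  have hφ : Function.Bijective φ := by
    constructor
    · rintro ⟨i, h, hh⟩ ⟨j, h', hh'⟩ e
      have e' : T i * h = T j * h' := congrArg Subtype.val e
      obtain rfl : i = j := by
        apply hinj
        simp only [Function.comp_apply]
        rw [← hfH h hh, e', hfH h' hh']
      obtain rfl : h = h' := mul_left_cancel e'
      rfl
    · rintro ⟨g, hg⟩
      obtain ⟨i, h, hh, rfl⟩ := hcover g hg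
      exact ⟨(i, ⟨h, hh⟩), rfl⟩
  rw [← Nat.card_congr (Equiv.ofBijective φ hφ), Nat.card_prod, Nat.card_fin]

/-- The case of `card_closure_range_eq_mul` where left cosets are separated by the images of a
vector over `R` that is fixed by the generators of the subgroup. -/
theorem card_closure_range_eq_mul_of_mulVec {R m ι κ : Type*} [CommRing R] [Fintype m]
    [DecidableEq m] {n : ℕ} (σ : ι → GL m ℤ) (τ : κ → GL m ℤ) (T : Fin n → GL m ℤ) (v : m → R)
    (hτ : ∀ k, τ k ∈ Subgroup.closure (Set.range σ))
    (hone : ∃ i, T i = 1)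
    (hT : ∀ i, T i = 1 ∨ ∃ j < i, ∃ s, T i = σ s * T j)
    (hmul : ∀ s i, ∃ j, ∃ h ∈ Subgroup.closure (Set.range τ), σ s * T i = T j * h)
    (hv : ∀ k, ((τ k).val.map (Int.cast : ℤ → R)).mulVec v = v)
    (hinj : Function.Injective fun i => ((T i).val.map (Int.cast : ℤ → R)).mulVec v) :
    Nat.card (Subgroup.closure (Set.range σ)) =
      n * Nat.card (Subgroup.closure (Set.range τ)) := by
  refine card_closure_range_eq_mul σ τ T
    (fun g => (g.val.map (Int.cast : ℤ → R)).mulVec v) hτ hone hT hmul (fun g k => ?_) hinj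
  have hmap : (g.val * (τ k).val).map (Int.cast : ℤ → R) =
      g.val.map Int.cast * (τ k).val.map Int.cast :=
    Matrix.map_mul (f := Int.castRingHom R)
  rw [Units.val_mul, hmap, ← Matrix.mulVec_mulVec, hv]

namespace WeylF4

/-- The simple reflection `e₀ - e₁` of a root subsystem of type `B₄`. -/
def a : GL (Fin 4) ℤ :=
  ⟨!![1,-1,0,1; 0,0,0,1; 0,0,1,0; 0,1,0,0], !![1,-1,0,1; 0,0,0,1; 0,0,1,0; 0,1,0,0],
    by decide, by decide⟩

/-- The simple reflection `e₁ - e₂`. -/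
def b : GL (Fin 4) ℤ :=
  ⟨!![1,0,0,0; 1,-1,1,0; 0,0,1,0; 0,0,0,1], !![1,0,0,0; 1,-1,1,0; 0,0,1,0; 0,0,0,1],
    by decide, by decide⟩

/-- The simple reflection `e₂ - e₃`. -/
def c : GL (Fin 4) ℤ :=
  ⟨!![-1,1,0,-1; 0,1,0,0; 0,0,1,0; 0,0,0,1], !![-1,1,0,-1; 0,1,0,0; 0,0,1,0; 0,0,0,1],
    by decide, by decide⟩

/-- The simple reflection `e₃`. -/
def d : GL (Fin 4) ℤ :=
  ⟨!![0,0,1,-1; 0,1,0,0; 1,0,0,1; 0,0,0,1], !![0,0,1,-1; 0,1,0,0; 1,0,0,1; 0,0,0,1],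
    by decide, by decide⟩

/-- An element of order three permuting the three subsystems of type `B₄`. -/
def t : GL (Fin 4) ℤ :=
  ⟨!![1,0,-1,1; 0,1,-1,0; 0,0,0,-1; 0,0,1,-1], !![1,0,0,1; 0,1,-1,1; 0,0,-1,1; 0,0,-1,0],
    by decide, by decide⟩

theorem card_closure_d : Nat.card (Subgroup.closure (Set.range ![d])) = 2 := by
  rw [card_closure_range_eq_mul_of_mulVec ![d] (![] : Fin 0 → GL (Fin 4) ℤ) ![1, d]
    (![1,0,-1,0] : Fin 4 → ℤ) (fun k => k.elim0) ⟨0, rfl⟩ (by decide +kernel) ?_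
    (fun k => k.elim0) (by decide +kernel)]
  · simp
  · have key : ∀ s i, ∃ j, ![d] s * ![1, d] i = ![1, d] j := by decide +kernel
    intro s i
    obtain ⟨j, e⟩ := key s i
    exact ⟨j, 1, one_mem _, by rw [e, mul_one]⟩

/-- A version of the counting lemma for Coxeter generators, where every generator either permutes
representatives or moves past them as another generator. -/
theorem card_closure_cons {m n : ℕ} (r : GL (Fin 4) ℤ) (τ : Fin m → GL (Fin 4) ℤ)
    (T : Fin n → GL (Fin 4) ℤ) (v : Fin 4 → ℤ)
    (hone : ∃ i, T i = 1)
    (hT : ∀ i, T i = 1 ∨ ∃ j < i, ∃ s, T i = Matrix.vecCons r τ s * T j)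
    (hmul : ∀ s i, ∃ j, Matrix.vecCons r τ s * T i = T j ∨
      ∃ k, Matrix.vecCons r τ s * T i = T j * τ k)
    (hv : ∀ k, ((τ k).val.map (Int.cast : ℤ → ℤ)).mulVec v = v)
    (hinj : Function.Injective fun i => ((T i).val.map (Int.cast : ℤ → ℤ)).mulVec v) :
    Nat.card (Subgroup.closure (Set.range (Matrix.vecCons r τ))) =
      n * Nat.card (Subgroup.closure (Set.range τ)) := by
  refine card_closure_range_eq_mul_of_mulVec _ τ T v
    (fun k => Subgroup.subset_closure ⟨k.succ, rfl⟩) hone hT (fun s i => ?_) hv hinj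
  obtain ⟨j, e | ⟨k, e⟩⟩ := hmul s i
  · exact ⟨j, 1, one_mem _, by rw [e, mul_one]⟩
  · exact ⟨j, τ k, Subgroup.subset_closure ⟨k, rfl⟩, e⟩

theorem card_closure_cd : Nat.card (Subgroup.closure (Set.range ![c, d])) = 8 := by
  rw [card_closure_cons c ![d] ![1, c, d * c, c * (d * c)] ![-1,0,-1,0] ⟨0, rfl⟩
    (by decide +kernel) (by decide +kernel) (by decide +kernel) (by decide +kernel),
    card_closure_d]

theorem card_closure_bcd : Nat.card (Subgroup.closure (Set.range ![b, c, d])) = 48 := by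
  rw [card_closure_cons b ![c, d]
    ![1, b, c * b, d * (c * b), c * (d * (c * b)), b * (c * (d * (c * b)))]
    ![-1,-2,-1,0] ⟨0, rfl⟩
    (by decide +kernel) (by decide +kernel) (by decide +kernel) (by decide +kernel),
    card_closure_cd]

theorem card_closure_abcd : Nat.card (Subgroup.closure (Set.range ![a, b, c, d])) = 384 := by
  rw [card_closure_cons a ![b, c, d]
    ![1, a, b * a, c * (b * a), d * (c * (b * a)), c * (d * (c * (b * a))),
      b * (c * (d * (c * (b * a)))), a * (b * (c * (d * (c * (b * a)))))]
    ![1,0,-1,-2] ⟨0, rfl⟩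
    (by decide +kernel) (by decide +kernel) (by decide +kernel) (by decide +kernel),
    card_closure_bcd]

/-- The group generated by the given matrices contains the Weyl group of type `B₄` as a subgroup of
index three; the cosets are separated by their action modulo two. -/
theorem card_closure_generators :
    Nat.card (Subgroup.closure (Set.range ![c * b, c, d, t])) = 1152 := by
  have hmem : ∀ s, ![c * b, c, d, t] s ∈ Subgroup.closure (Set.range ![c * b, c, d, t]) :=
    fun s => Subgroup.subset_closure ⟨s, rfl⟩
  have hτ : ∀ k, ![a, b, c, d] k ∈ Subgroup.closure (Set.range ![c * b, c, d, t]) := by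
    have ha : a = t * (d * (c * (d * (t * t)))) := by decide +kernel
    have hb : b = c * (c * b) := by decide +kernel
    have hc := hmem 1
    have hd := hmem 2
    have ht := hmem 3
    intro k
    fin_cases k
    · change a ∈ _
      rw [ha]
      exact mul_mem ht (mul_mem hd (mul_mem hc (mul_mem hd (mul_mem ht ht))))
    · convert mul_mem hc (hmem 0) using 1
      exact hb
    · exact hc
    · exact hd
  rw [card_closure_range_eq_mul_of_mulVec _ ![a, b, c, d] ![1, t, d * t]
    (![1,0,1,0] : Fin 4 → ZMod 2) hτ ⟨0, rfl⟩ (by decide +kernel) ?_ (by decide +kernel)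
    (by decide +kernel), card_closure_abcd]
  have key : ∀ s i, ∃ j, ∃ w ∈ [[], [1], [2], [3], [2, 1],
      [1, 0, 2, 1, 3, 2, 1, 0, 3, 2], [1, 0, 2, 1, 3, 2, 1, 0, 3, 2, 1],
      [3, 2, 1, 0, 3, 2, 1, 3, 2], [2, 1, 0, 3, 2, 1, 3, 2, 3]],
      ![c * b, c, d, t] s * ![1, t, d * t] i =
        ![1, t, d * t] j * (w.map ![a, b, c, d]).prod := by decide +kernel
  intro s i
  obtain ⟨j, w, -, e⟩ := key s i
  refine ⟨j, _, Subgroup.list_prod_mem _ fun x hx => ?_, e⟩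
  obtain ⟨k, -, rfl⟩ := List.mem_map.mp hx
  exact Subgroup.subset_closure ⟨k, rfl⟩

end WeylF4

/-- The subgroup of GL₄(ℤ) generated by the matrices s₁, s₂, s₃, s₄ (the Weyl group of
the root system F₄) is a finite group of order 1152. -/
theorem stmt_10 (s₁ s₂ s₃ s₄ : GL (Fin 4) ℤ)
    (h₁ : (s₁ : Matrix (Fin 4) (Fin 4) ℤ) = !![0,-1,1,-1; 1,-1,1,0; 0,0,1,0; 0,0,0,1])
    (h₂ : (s₂ : Matrix (Fin 4) (Fin 4) ℤ) = !![-1,1,0,-1; 0,1,0,0; 0,0,1,0; 0,0,0,1])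
    (h₃ : (s₃ : Matrix (Fin 4) (Fin 4) ℤ) = !![0,0,1,-1; 0,1,0,0; 1,0,0,1; 0,0,0,1])
    (h₄ : (s₄ : Matrix (Fin 4) (Fin 4) ℤ) = !![1,0,-1,1; 0,1,-1,0; 0,0,0,-1; 0,0,1,-1]) :
    Nat.card (Subgroup.closure {s₁, s₂, s₃, s₄} : Subgroup (GL (Fin 4) ℤ)) = 1152 := by
  have e₁ : s₁ = WeylF4.c * WeylF4.b := Units.ext (h₁.trans (by decide +kernel))
  have e₂ : s₂ = WeylF4.c := Units.ext h₂
  have e₃ : s₃ = WeylF4.d := Units.ext h₃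
  have e₄ : s₄ = WeylF4.t := Units.ext h₄
  rw [← WeylF4.card_closure_generators, e₁, e₂, e₃, e₄]
  simp only [Matrix.range_cons, Matrix.range_empty, Set.union_empty, Set.insert_eq]
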